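/- For every k ≥ 2 and D > 0 there exist constants C', m₀ and ε₀ > 0 such that the following holds. Let c be a fully dense weakly fragile arity-k constraint system on a finite set U with |U| = m ≥ m₀, let 0 < ε ≤ ε₀, let π be a ranking of U and σ an ordering of U with |π(x) − σ(x)| ≤ D·ε·m for all x ∈ U. Then for all distinct u, v ∈ U: w̄^σ_{uv} ≤ (1 + C'·ε) · w^π_{uv}. -/

import Mathlib

open scoped Classical

universe u

noncomputable section

variable {α : Type u}

/-- `f` and `g` order the elements of `S` the same way. -/
def SameOrderOn (S : Finset α) (f g : α → ℝ) : Prop :=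
  ∀ x ∈ S, ∀ y ∈ S, (f x < f y ↔ g x < g y)

/-- An ordering of `S` is an injection of `S` into `ℝ`. -/
def IsOrderingOn (S : Finset α) (σ : α → ℝ) : Prop :=
  Set.InjOn σ ↑S

/-- A ranking of `S` is a bijection from `S` onto `{1, …, |S|}`. -/
def IsRankingOn (S : Finset α) (π : α → ℝ) : Prop :=
  Set.BijOn π ↑S ((fun i : ℕ => (i : ℝ)) '' Set.Icc 1 S.card)

/-- The rankings `π` and `π'` of `S` differ by the move of a single vertex:
`π' = Ranking(v ↦ p ⊕ π|_{S∖{v}})` for some `v ∈ S` and half-integer `p`,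
and the two rankings differ. -/
def SingleMove (S : Finset α) (π π' : α → ℝ) : Prop :=
  ∃ v ∈ S, ∃ p : ℝ, (∃ m : ℤ, p = (m : ℝ) + 1 / 2) ∧
    SameOrderOn S π' (Function.update π v p) ∧ ∃ x ∈ S, π x ≠ π' x

/-- The rankings `π` and `π'` of `S` differ by one of the four weak single-vertex moves:
swap the first two vertices, swap the last two, or move the first or last vertex to the
other end; formally `π' = Ranking(v ↦ p ⊕ π|_{S∖{v}})` with
`(π v, p) ∈ {(1, 2+1/2), (1, k+1/2), (k, k−3/2), (k, 1/2)}` where `k = |S|`. -/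
def WeakMove (S : Finset α) (π π' : α → ℝ) : Prop :=
  ∃ v ∈ S, ∃ p : ℝ,
    ((π v = 1 ∧ p = 2 + 1 / 2) ∨ (π v = 1 ∧ p = (S.card : ℝ) + 1 / 2) ∨
      (π v = (S.card : ℝ) ∧ p = (S.card : ℝ) - 3 / 2) ∨
      (π v = (S.card : ℝ) ∧ p = 1 / 2)) ∧
    SameOrderOn S π' (Function.update π v p) ∧ ∃ x ∈ S, π x ≠ π' x

/-- A constraint `c` on `S` is fragile if any two rankings of `S` differing by the move of
a single vertex satisfy `c π + c π' ≥ 1`. -/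
def FragileOn (S : Finset α) (c : (α → ℝ) → ℕ) : Prop :=
  ∀ π π' : α → ℝ, IsRankingOn S π → IsRankingOn S π' → SingleMove S π π' → 1 ≤ c π + c π'

/-- A constraint `c` on `S` is weakly fragile if any two rankings of `S` differing by one of
the four weak moves satisfy `c π + c π' ≥ 1`. -/
def WeaklyFragileOn (S : Finset α) (c : (α → ℝ) → ℕ) : Prop :=
  ∀ π π' : α → ℝ, IsRankingOn S π → IsRankingOn S π' → WeakMove S π π' → 1 ≤ c π + c π'

/-- A (fully dense) arity-`k` constraint system on `U`: to every `k`-subset `S` of `U` it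
assigns a `{0,1}`-valued cost `c S` which depends only on the relative order of its
argument on `S` (so `c S σ` is the cost of the ranking of `S` induced by `σ`). -/
def IsConstraintSystem (U : Finset α) (k : ℕ) (c : Finset α → (α → ℝ) → ℕ) : Prop :=
  ∀ S ∈ U.powersetCard k,
    (∀ σ : α → ℝ, c S σ ≤ 1) ∧ ∀ σ σ' : α → ℝ, SameOrderOn S σ σ' → c S σ = c S σ'

/-- Every constraint of the system is weakly fragile. -/
def WeaklyFragileSystem (U : Finset α) (k : ℕ) (c : Finset α → (α → ℝ) → ℕ) : Prop :=
  ∀ S ∈ U.powersetCard k, WeaklyFragileOn S (c S)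

/-- The cost `C^c(σ) = Σ_{S ⊆ U, |S| = k} c(σ|_S)` of an ordering `σ`. -/
def cost (U : Finset α) (k : ℕ) (c : Finset α → (α → ℝ) → ℕ) (σ : α → ℝ) : ℕ :=
  ∑ S ∈ U.powersetCard k, c S σ

/-- `b^c(σ, v, p) = Σ_{Q ⊆ U∖{v}, |Q| = k−1} c(σ|_Q ⊕ v ↦ p)`: the cost of the
constraints involving `v` after moving `v` to position `p` (here `U` is the domain of `σ`). -/
def bcost (U : Finset α) (k : ℕ) (c : Finset α → (α → ℝ) → ℕ) (σ : α → ℝ) (v : α) (p : ℝ) : ℕ :=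
  ∑ Q ∈ (U.erase v).powersetCard (k - 1), c (insert v Q) (Function.update σ v p)

/-- The rank of `x` within `S` under the ordering `σ`. -/
def rk (S : Finset α) (σ : α → ℝ) (x : α) : ℕ :=
  (S.filter fun y => σ y ≤ σ x).card

/-- The ordering of `S` obtained from `σ` by moving `v` to a position immediately
before `u` (all other vertices of `S` keeping their relative order). -/
def moveBefore (S : Finset α) (σ : α → ℝ) (v u : α) : α → ℝ :=
  Function.update (fun x => (rk S σ x : ℝ)) v ((rk S σ u : ℝ) - 1 / 2)

/-- The feedback-arc-set weight `w^σ_{uv}`: the number of `k`-subsets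
`{u,v} ⊆ S ⊆ U` with `c(σ') = 1`, where `σ' = σ|_{S∖{v}} ⊕ v ↦ p` and `p` places `v`
immediately before `u` if `σ v > σ u`, and `p = σ v` otherwise. -/
def wgt (U : Finset α) (k : ℕ) (c : Finset α → (α → ℝ) → ℕ) (σ : α → ℝ) (u v : α) : ℕ :=
  ((U.powersetCard k).filter fun S =>
    u ∈ S ∧ v ∈ S ∧ if σ u < σ v then c S (moveBefore S σ v u) = 1 else c S σ = 1).card

/-- The canceled weights
`w̄^σ_{uv} = w^σ_{uv} − min((1/(10·3^{k−1}))·C(|U|−2, k−2), w^σ_{uv}, w^σ_{vu})`. -/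
def wbar (U : Finset α) (k : ℕ) (c : Finset α → (α → ℝ) → ℕ) (σ : α → ℝ) (u v : α) : ℝ :=
  (wgt U k c σ u v : ℝ) -
    min (1 / (10 * 3 ^ (k - 1)) * ((U.card - 2).choose (k - 2) : ℝ))
      (min (wgt U k c σ u v : ℝ) (wgt U k c σ v u : ℝ))

/-- The feedback-arc-set cost `C^w(σ) = Σ_{u,v ∈ U : σ(u) > σ(v)} w_{uv}`. -/
def costW (U : Finset α) (w : α → α → ℝ) (σ : α → ℝ) : ℝ :=
  ∑ x ∈ U, ∑ y ∈ U, if σ y < σ x then w x y else 0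

/-- `b^w(σ, v, p) = Σ_{u ≠ v} (w_{uv} if σ(u) > p, w_{vu} if σ(u) < p)`. -/
def bW (U : Finset α) (w : α → α → ℝ) (σ : α → ℝ) (v : α) (p : ℝ) : ℝ :=
  ∑ x ∈ U.erase v, if p < σ x then w x v else if σ x < p then w v x else 0

/-- The Kendall tau distance: the number of `σ/σ'`-inversions, i.e. of unordered pairs
`{u,v} ⊆ S` on which `σ` and `σ'` disagree. -/
def kendall (S : Finset α) (σ σ' : α → ℝ) : ℕ :=
  ((S ×ˢ S).filter fun q => σ q.1 < σ q.2 ∧ σ' q.2 < σ' q.1).card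

/-- `Round(π)`: each position is rounded down to the nearest multiple of `e = εn`, with
ties broken by adding `u/(n+1)`. -/
def roundOrd (n e : ℕ) (π : ℕ → ℝ) : ℕ → ℝ :=
  fun u => (e : ℝ) * (⌊π u / (e : ℝ)⌋ : ℝ) + (u : ℝ) / ((n : ℝ) + 1)

end

section

variable {α : Type u}

lemma rk_lt_rk_iff {S : Finset α} {σ : α → ℝ} {x y : α} (hy : y ∈ S) :
    rk S σ x < rk S σ y ↔ σ x < σ y := by
  constructor
  · intro h
    by_contra! hle
    refine absurd h (not_lt.2 (Finset.card_le_card fun z hz => ?_))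
    simp only [Finset.mem_filter] at hz ⊢
    exact ⟨hz.1, hz.2.trans hle⟩
  · intro h
    refine Finset.card_lt_card (Finset.ssubset_iff_of_subset (fun z hz => ?_) |>.2 ⟨y, ?_, ?_⟩)
    · simp only [Finset.mem_filter] at hz ⊢
      exact ⟨hz.1, hz.2.trans h.le⟩
    · simp [hy]
    · simp [h]

lemma rk_le_rk_iff {S : Finset α} {σ : α → ℝ} {x y : α} (hx : x ∈ S) :
    rk S σ x ≤ rk S σ y ↔ σ x ≤ σ y := by
  rw [← not_lt, ← not_lt, rk_lt_rk_iff hx]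

lemma SameOrderOn.trans {S : Finset α} {f g h : α → ℝ} (hfg : SameOrderOn S f g)
    (hgh : SameOrderOn S g h) : SameOrderOn S f h :=
  fun x hx y hy => (hfg x hx y hy).trans (hgh x hx y hy)

lemma sameOrderOn_rk (S : Finset α) (σ : α → ℝ) :
    SameOrderOn S (fun x => (rk S σ x : ℝ)) σ :=
  fun _ _ _ hy => Nat.cast_lt.trans (rk_lt_rk_iff hy)

lemma rk_pos {S : Finset α} {σ : α → ℝ} {x : α} (hx : x ∈ S) : 1 ≤ rk S σ x :=
  Finset.card_pos.2 ⟨x, by simp [hx]⟩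

lemma isRankingOn_rk {S : Finset α} {σ : α → ℝ} (hσ : IsOrderingOn S σ) :
    IsRankingOn S (fun x => (rk S σ x : ℝ)) := by
  have hinj : Set.InjOn (rk S σ) ↑S := fun x hx y hy hxy =>
    hσ hx hy (le_antisymm ((rk_le_rk_iff hx).1 hxy.le) ((rk_le_rk_iff hy).1 hxy.ge))
  have himg : S.image (rk S σ) = Finset.Icc 1 S.card := by
    refine Finset.eq_of_subset_of_card_le (fun i hi => ?_) ?_
    · obtain ⟨x, hx, rfl⟩ := Finset.mem_image.1 hi
      exact Finset.mem_Icc.2 ⟨rk_pos hx, Finset.card_le_card (Finset.filter_subset _ _)⟩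
    · rw [Finset.card_image_of_injOn hinj]
      simp
  have himg' : Set.Icc 1 S.card = rk S σ '' ↑S := by
    rw [← Finset.coe_image, himg, Finset.coe_Icc]
  rw [IsRankingOn, himg', Set.image_image]
  exact Set.InjOn.bijOn_image fun x hx y hy hxy => hinj hx hy (Nat.cast_injective hxy)

lemma moveBefore_self (S : Finset α) (σ : α → ℝ) (v u : α) :
    moveBefore S σ v u v = (rk S σ u : ℝ) - 1 / 2 := by
  simp [moveBefore]

lemma moveBefore_of_ne (S : Finset α) (σ : α → ℝ) {v x : α} (u : α) (h : x ≠ v) :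
    moveBefore S σ v u x = rk S σ x := by
  simp [moveBefore, h]

lemma natCast_sub_half_lt_iff (a b : ℕ) : (a : ℝ) - 1 / 2 < b ↔ a ≤ b := by
  constructor
  · intro h
    by_contra! hlt
    have : (b : ℝ) + 1 ≤ a := by exact_mod_cast hlt
    linarith
  · intro h
    have : (a : ℝ) ≤ b := by exact_mod_cast h
    linarith

lemma natCast_lt_sub_half_iff (a b : ℕ) : (a : ℝ) < b - 1 / 2 ↔ a < b := by
  constructor
  · intro h
    have : (a : ℝ) < b := by linarith
    exact_mod_cast this
  · intro h
    have : (a : ℝ) + 1 ≤ b := by exact_mod_cast h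
    linarith

lemma moveBefore_lt_iff {S : Finset α} {σ : α → ℝ} {v u x y : α} (hy : y ∈ S)
    (hxv : x ≠ v) (hyv : y ≠ v) :
    moveBefore S σ v u x < moveBefore S σ v u y ↔ σ x < σ y := by
  rw [moveBefore_of_ne _ _ _ hxv, moveBefore_of_ne _ _ _ hyv, Nat.cast_lt, rk_lt_rk_iff hy]

lemma moveBefore_self_lt_iff {S : Finset α} {σ : α → ℝ} {v u y : α} (hu : u ∈ S)
    (hyv : y ≠ v) :
    moveBefore S σ v u v < moveBefore S σ v u y ↔ σ u ≤ σ y := by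
  rw [moveBefore_self, moveBefore_of_ne _ _ _ hyv, natCast_sub_half_lt_iff, rk_le_rk_iff hu]

lemma moveBefore_lt_self_iff {S : Finset α} {σ : α → ℝ} {v u y : α} (hu : u ∈ S)
    (hyv : y ≠ v) :
    moveBefore S σ v u y < moveBefore S σ v u v ↔ σ y < σ u := by
  rw [moveBefore_self, moveBefore_of_ne _ _ _ hyv, natCast_lt_sub_half_iff, rk_lt_rk_iff hu]

lemma isOrderingOn_moveBefore {S : Finset α} {σ : α → ℝ} (hσ : IsOrderingOn S σ) {u : α}
    (v : α) (hu : u ∈ S) : IsOrderingOn S (moveBefore S σ v u) := by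
  intro x hx y hy hxy
  by_cases hxv : x = v
  · by_cases hyv : y = v
    · rw [hxv, hyv]
    · subst hxv
      have h1 := (moveBefore_self_lt_iff (σ := σ) hu hyv).not.1 hxy.not_lt
      have h2 := (moveBefore_lt_self_iff (σ := σ) hu hyv).not.1 hxy.symm.not_lt
      exact absurd (not_le.1 h1) h2
  · by_cases hyv : y = v
    · subst hyv
      have h1 := (moveBefore_self_lt_iff (σ := σ) hu hxv).not.1 hxy.symm.not_lt
      have h2 := (moveBefore_lt_self_iff (σ := σ) hu hxv).not.1 hxy.not_lt
      exact absurd (not_le.1 h1) h2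
    · have h1 := (moveBefore_lt_iff (u := u) hy hxv hyv).not.1 hxy.not_lt
      have h2 := (moveBefore_lt_iff (u := u) hx hyv hxv).not.1 hxy.symm.not_lt
      exact hσ hx hy (le_antisymm (not_lt.1 h2) (not_lt.1 h1))

/-- The ordering of `S` evaluated by `w^σ_{uv}`. -/
noncomputable def placeBefore (S : Finset α) (σ : α → ℝ) (u v : α) : α → ℝ :=
  if σ u < σ v then moveBefore S σ v u else σ

lemma wgt_eq_card_filter (U : Finset α) (k : ℕ) (c : Finset α → (α → ℝ) → ℕ) (σ : α → ℝ)
    (u v : α) :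
    wgt U k c σ u v = ((U.powersetCard k).filter fun S =>
      u ∈ S ∧ v ∈ S ∧ c S (placeBefore S σ u v) = 1).card := by
  unfold wgt placeBefore
  congr 1
  refine Finset.filter_congr fun S _ => ?_
  split_ifs <;> rfl

lemma placeBefore_lt_iff {S : Finset α} {σ : α → ℝ} {u v x y : α} (hy : y ∈ S)
    (hxv : x ≠ v) (hyv : y ≠ v) :
    placeBefore S σ u v x < placeBefore S σ u v y ↔ σ x < σ y := by
  unfold placeBefore
  split_ifs
  · exact moveBefore_lt_iff hy hxv hyv
  · rfl

lemma placeBefore_right_lt_left {S : Finset α} {σ : α → ℝ} {u v : α} (hσ : IsOrderingOn S σ)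
    (hu : u ∈ S) (hv : v ∈ S) (huv : u ≠ v) :
    placeBefore S σ u v v < placeBefore S σ u v u := by
  unfold placeBefore
  split_ifs with h
  · exact (moveBefore_self_lt_iff hu huv).2 le_rfl
  · exact lt_of_le_of_ne (not_lt.1 h) fun he => huv (hσ hu hv he.symm)

lemma placeBefore_self_lt_iff {S : Finset α} {σ : α → ℝ} {u v y : α} (hσ : IsOrderingOn S σ)
    (hu : u ∈ S) (hy : y ∈ S) (hyu : y ≠ u) (hyv : y ≠ v) :
    placeBefore S σ u v v < placeBefore S σ u v y ↔ σ u < σ y ∨ σ v < σ y := by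
  have hne : σ u ≠ σ y := fun he => hyu (hσ hu hy he).symm
  unfold placeBefore
  split_ifs with h
  · rw [moveBefore_self_lt_iff hu hyv]
    exact ⟨fun h' => .inl (lt_of_le_of_ne h' hne), fun h' => h'.elim le_of_lt (h.trans · |>.le)⟩
  · exact ⟨.inr, fun h' => h'.elim ((not_lt.1 h).trans_lt ·) id⟩

lemma placeBefore_lt_self_iff {S : Finset α} {σ : α → ℝ} {u v y : α}
    (hu : u ∈ S) (hyv : y ≠ v) :
    placeBefore S σ u v y < placeBefore S σ u v v ↔ σ y < σ u ∧ σ y < σ v := by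
  unfold placeBefore
  split_ifs with h
  · rw [moveBefore_lt_self_iff hu hyv]
    exact ⟨fun h' => ⟨h', h'.trans h⟩, And.left⟩
  · exact ⟨fun h' => ⟨h'.trans_le (not_lt.1 h), h'⟩, And.right⟩

lemma sameOrderOn_placeBefore {S : Finset α} {σ π : α → ℝ} {u v : α} (hσ : IsOrderingOn S σ)
    (hπ : IsOrderingOn S π) (hu : u ∈ S) (hv : v ∈ S) (huv : u ≠ v)
    (h : ∀ x ∈ S, x ≠ u → x ≠ v → ∀ y ∈ S, y ≠ x → (σ x < σ y ↔ π x < π y)) :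
    SameOrderOn S (placeBefore S σ u v) (placeBefore S π u v) := by
  have h' : ∀ x ∈ S, x ≠ u → x ≠ v → ∀ y ∈ S, y ≠ x → (σ y < σ x ↔ π y < π x) := by
    intro x hx hxu hxv y hy hyx
    have e := (h x hx hxu hxv y hy hyx).not
    rw [not_lt, not_lt, le_iff_lt_or_eq, le_iff_lt_or_eq] at e
    have h1 : σ y ≠ σ x := fun he => hyx (hσ hy hx he)
    have h2 : π y ≠ π x := fun he => hyx (hπ hy hx he)
    simpa [h1, h2] using e
  intro x hx y hy
  by_cases hxy : y = x
  · subst hxy; simp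
  by_cases hxv : x = v
  · subst hxv
    by_cases hyu : y = u
    · subst hyu
      exact iff_of_true (placeBefore_right_lt_left hσ hu hv huv)
        (placeBefore_right_lt_left hπ hu hv huv)
    · rw [placeBefore_self_lt_iff hσ hu hy hyu hxy, placeBefore_self_lt_iff hπ hu hy hyu hxy,
        h' y hy hyu hxy u hu (Ne.symm hyu), h' y hy hyu hxy x hx (Ne.symm hxy)]
  · by_cases hyv : y = v
    · subst hyv
      by_cases hxu : x = u
      · subst hxu
        exact iff_of_false (placeBefore_right_lt_left hσ hu hv huv).not_gt
          (placeBefore_right_lt_left hπ hu hv huv).not_gt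
      · rw [placeBefore_lt_self_iff hu hxv, placeBefore_lt_self_iff hu hxv,
          h x hx hxu hxv u hu (Ne.symm hxu), h x hx hxu hxv y hy hxy]
    · rw [placeBefore_lt_iff hy hxv hyv, placeBefore_lt_iff hy hxv hyv]
      by_cases hxu : x = u
      · by_cases hyu : y = u
        · exact absurd (hyu.trans hxu.symm) hxy
        · exact h' y hy hyu hyv x hx (Ne.symm hxy)
      · exact h x hx hxu hxv y hy hxy

lemma IsRankingOn.isOrderingOn {S : Finset α} {π : α → ℝ} (h : IsRankingOn S π) :
    IsOrderingOn S π :=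
  h.injOn

lemma IsOrderingOn.mono {S T : Finset α} {σ : α → ℝ} (h : IsOrderingOn T σ) (hST : S ⊆ T) :
    IsOrderingOn S σ :=
  Set.InjOn.mono (Finset.coe_subset.2 hST) h

lemma IsRankingOn.card_near_le {U : Finset α} {π : α → ℝ} (hπ : IsRankingOn U π) {x : α}
    (hx : x ∈ U) {Δ : ℝ} (hΔ : 0 ≤ Δ) :
    (((U.erase x).filter fun y => |π x - π y| ≤ Δ).card : ℝ) ≤ 2 * Δ := by
  have hint : ∀ y ∈ U, ((⌊π y⌋ : ℤ) : ℝ) = π y := by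
    intro y hy
    obtain ⟨i, -, hi⟩ := hπ.mapsTo hy
    simp only at hi
    rw [← hi]
    simp
  have hfl : (0 : ℤ) ≤ ⌊Δ⌋ := Int.floor_nonneg.2 hΔ
  have hcard : ((U.erase x).filter fun y => |π x - π y| ≤ Δ).card ≤
      ((Finset.Icc (-⌊Δ⌋) ⌊Δ⌋).erase 0).card := by
    refine Finset.card_le_card_of_injOn (fun y => ⌊π y⌋ - ⌊π x⌋) ?_ ?_
    · intro y hy
      simp only [Finset.coe_filter, Finset.mem_erase, Set.mem_ofPred_eq] at hy
      obtain ⟨⟨hyx, hyU⟩, hd⟩ := hy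
      rw [← hint x hx, ← hint y hyU, abs_le] at hd
      simp only [Finset.coe_erase, Finset.coe_Icc, Set.mem_sdiff, Set.mem_Icc,
        Set.mem_singleton_iff]
      refine ⟨⟨?_, ?_⟩, ?_⟩
      · rw [neg_le]
        apply Int.le_floor.2
        push_cast
        linarith
      · apply Int.le_floor.2
        push_cast
        linarith
      · intro h0
        apply hyx
        apply hπ.injOn hyU hx
        rw [← hint x hx, ← hint y hyU, sub_eq_zero.1 h0]
    · intro y hy z hz hyz
      simp only [Finset.coe_filter, Finset.mem_erase, Set.mem_ofPred_eq] at hy hz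
      apply hπ.injOn hy.1.2 hz.1.2
      rw [← hint y hy.1.2, ← hint z hz.1.2]
      congr 1
      simpa using hyz
  rw [Finset.card_erase_of_mem (by simp [hfl]), Int.card_Icc] at hcard
  have h2 : (((U.erase x).filter fun y => |π x - π y| ≤ Δ).card : ℤ) ≤ 2 * ⌊Δ⌋ := by omega
  calc (((U.erase x).filter fun y => |π x - π y| ≤ Δ).card : ℝ) ≤ 2 * (⌊Δ⌋ : ℝ) := by
        exact_mod_cast h2
    _ ≤ 2 * Δ := by linarith [Int.floor_le Δ]

lemma card_powersetCard_filter_superset_le {U A : Finset α} (hA : A ⊆ U) {k : ℕ} :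
    ((U.powersetCard k).filter fun S => A ⊆ S).card ≤
      if A.card ≤ k then (U.card - A.card).choose (k - A.card) else 0 := by
  split_ifs with h
  · rw [← Finset.card_sdiff_of_subset hA, ← Finset.card_powersetCard]
    refine Finset.card_le_card_of_injOn (fun S => S \ A) ?_ ?_
    · intro S hS
      simp only [Finset.coe_filter, Finset.mem_powersetCard, Set.mem_ofPred_eq] at hS
      rw [Finset.mem_coe,
        Finset.mem_powersetCard]
      exact ⟨Finset.sdiff_subset_sdiff hS.1.1 le_rfl,
        by rw [Finset.card_sdiff_of_subset hS.2, hS.1.2]⟩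
    · intro S hS T hT hST
      simp only [Finset.coe_filter, Finset.mem_powersetCard, Set.mem_ofPred_eq] at hS hT
      simp only at hST
      rw [← Finset.sdiff_union_of_subset hS.2, hST, Finset.sdiff_union_of_subset hT.2]
  · rw [Nat.le_zero, Finset.card_eq_zero, Finset.filter_eq_empty_iff]
    intro S hS hAS
    exact h ((Finset.mem_powersetCard.1 hS).2 ▸ Finset.card_le_card hAS)

lemma choose_sub_succ_mul_le {m k a : ℕ} (ham : a + 1 ≤ m) :
    (if a + 1 ≤ k then (m - (a + 1)).choose (k - (a + 1)) else 0) * (m - a) ≤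
      k * (if a ≤ k then (m - a).choose (k - a) else 0) := by
  by_cases h : a + 1 ≤ k
  · rw [if_pos h, if_pos (by omega)]
    obtain ⟨b, rfl⟩ := Nat.exists_eq_add_of_le h
    obtain ⟨n, rfl⟩ := Nat.exists_eq_add_of_le ham
    have e1 : a + 1 + n - (a + 1) = n := by omega
    have e2 : a + 1 + b - (a + 1) = b := by omega
    have e3 : a + 1 + n - a = n + 1 := by omega
    have e4 : a + 1 + b - a = b + 1 := by omega
    rw [e1, e2, e3, e4, mul_comm, Nat.add_one_mul_choose_eq, mul_comm]
    exact Nat.mul_le_mul_right _ (by omega)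
  · simp [h]

lemma lt_iff_lt_of_abs_sub_le {a b a' b' δ : ℝ} (ha : |a - a'| ≤ δ) (hb : |b - b'| ≤ δ)
    (h : 2 * δ < |a - b|) : a' < b' ↔ a < b := by
  rw [abs_le] at ha hb
  rcases lt_abs.1 h with h | h <;> constructor <;> intro <;> linarith

/-- The `k`-subsets of `U` containing `u` and `v` in which some vertex other than `u` and `v` is
`Δ`-close under `π` to another vertex. -/
noncomputable def closeSets (U : Finset α) (k : ℕ) (π : α → ℝ) (Δ : ℝ) (u v : α) :
    Finset (Finset α) :=
  (U.powersetCard k).filter fun S =>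
    u ∈ S ∧ v ∈ S ∧ ∃ x ∈ S, x ≠ u ∧ x ≠ v ∧ ∃ y ∈ S, y ≠ x ∧ |π x - π y| ≤ Δ

lemma wgt_le_wgt_add_card_closeSets {U : Finset α} {k : ℕ} {c : Finset α → (α → ℝ) → ℕ}
    (hc : IsConstraintSystem U k c) {π σ : α → ℝ} (hπ : IsOrderingOn U π)
    (hσ : IsOrderingOn U σ) {δ : ℝ} (hδ : ∀ x ∈ U, |π x - σ x| ≤ δ) {u v : α} (huv : u ≠ v) :
    wgt U k c σ u v ≤ wgt U k c π u v + (closeSets U k π (2 * δ) u v).card := by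
  rw [wgt_eq_card_filter, wgt_eq_card_filter]
  refine (Finset.card_le_card fun S hS => ?_).trans (Finset.card_union_le _ _)
  rw [Finset.mem_filter] at hS
  obtain ⟨hSU, hu, hv, h1⟩ := hS
  by_cases hclose : ∃ x ∈ S, x ≠ u ∧ x ≠ v ∧ ∃ y ∈ S, y ≠ x ∧ |π x - π y| ≤ 2 * δ
  · exact Finset.mem_union_right _ (Finset.mem_filter.2 ⟨hSU, hu, hv, hclose⟩)
  · push Not at hclose
    have hsub := (Finset.mem_powersetCard.1 hSU).1
    refine Finset.mem_union_left _ (Finset.mem_filter.2 ⟨hSU, hu, hv, ?_⟩)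
    rw [← h1]
    refine ((hc S hSU).2 _ _ ?_).symm
    refine sameOrderOn_placeBefore (hσ.mono hsub) (hπ.mono hsub) hu hv huv
      fun x hx hxu hxv y hy hyx => ?_
    exact lt_iff_lt_of_abs_sub_le (hδ x (hsub hx)) (hδ y (hsub hy)) (hclose x hx hxu hxv y hy hyx)

lemma choose_sub_succ_mul_card_le {m k a : ℕ} (ham : 2 * a ≤ m) (hm : 1 ≤ m) :
    (if a + 1 ≤ k then (m - (a + 1)).choose (k - (a + 1)) else 0) * m ≤
      2 * k * (if a ≤ k then (m - a).choose (k - a) else 0) := by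
  calc _ ≤ (if a + 1 ≤ k then (m - (a + 1)).choose (k - (a + 1)) else 0) * (2 * (m - a)) :=
        Nat.mul_le_mul_left _ (by omega)
    _ = 2 * ((if a + 1 ≤ k then (m - (a + 1)).choose (k - (a + 1)) else 0) * (m - a)) :=
        mul_left_comm _ _ _
    _ ≤ 2 * (k * (if a ≤ k then (m - a).choose (k - a) else 0)) :=
        Nat.mul_le_mul_left _ (choose_sub_succ_mul_le (by omega))
    _ = _ := (mul_assoc _ _ _).symm

lemma card_closeSets_le_add {U : Finset α} {k : ℕ} {π : α → ℝ} (hπ : IsRankingOn U π) {Δ : ℝ}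
    (hΔ : 0 ≤ Δ) {u v : α} (hu : u ∈ U) (hv : v ∈ U) (huv : u ≠ v) :
    ((closeSets U k π Δ u v).card : ℝ) ≤
      4 * Δ * ((if 3 ≤ k then (U.card - 3).choose (k - 3) else 0 : ℕ) : ℝ) +
        U.card * (2 * Δ * ((if 4 ≤ k then (U.card - 4).choose (k - 4) else 0 : ℕ) : ℝ)) := by
  set near : α → Finset α := fun x => (U.erase x).filter fun y => |π x - π y| ≤ Δ
  set n₃ : ℕ := if 3 ≤ k then (U.card - 3).choose (k - 3) else 0
  set n₄ : ℕ := if 4 ≤ k then (U.card - 4).choose (k - 4) else 0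
  set supersets : Finset α → Finset (Finset α) := fun A => (U.powersetCard k).filter fun S => A ⊆ S
  have hcard3 : ∀ x ∈ U, x ≠ u → x ≠ v → (supersets {u, v, x}).card ≤ n₃ := by
    intro x hx hxu hxv
    have h3 : ({u, v, x} : Finset α).card = 3 :=
      Finset.card_eq_three.2 ⟨u, v, x, huv, hxu.symm, hxv.symm, rfl⟩
    have := card_powersetCard_filter_superset_le (U := U) (A := {u, v, x}) (k := k)
      (by simp [Finset.insert_subset_iff, *])
    rwa [h3] at this
  have hcard4 : ∀ x ∈ U, x ≠ u → x ≠ v → ∀ y ∈ U, y ≠ u → y ≠ v → y ≠ x →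
      (supersets {y, u, v, x}).card ≤ n₄ := by
    intro x hx hxu hxv y hy hyu hyv hyx
    have h3 : ({u, v, x} : Finset α).card = 3 :=
      Finset.card_eq_three.2 ⟨u, v, x, huv, hxu.symm, hxv.symm, rfl⟩
    have h4 : ({y, u, v, x} : Finset α).card = 4 := by
      rw [Finset.card_insert_of_notMem (by simp [*]), h3]
    have := card_powersetCard_filter_superset_le (U := U) (A := {y, u, v, x}) (k := k)
      (by simp [Finset.insert_subset_iff, *])
    rwa [h4] at this
  have mem_near : ∀ x y, y ∈ near x ↔ (y ≠ x ∧ y ∈ U) ∧ |π x - π y| ≤ Δ := fun x y => by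
    rw [Finset.mem_filter, Finset.mem_erase]
  have mem_supersets : ∀ A S, S ∈ supersets A ↔ S ∈ U.powersetCard k ∧ A ⊆ S :=
    fun A S => Finset.mem_filter
  have hsub : closeSets U k π Δ u v ⊆
      (((near u).filter fun x => x ≠ v).biUnion fun x => supersets {u, v, x}) ∪
      (((near v).filter fun x => x ≠ u).biUnion fun x => supersets {u, v, x}) ∪
      (U.filter fun x => x ≠ u ∧ x ≠ v).biUnion fun x =>
        ((near x).filter fun y => y ≠ u ∧ y ≠ v).biUnion fun y => supersets {y, u, v, x} := by
    intro S hS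
    obtain ⟨hSU, huS, hvS, x, hx, hxu, hxv, y, hy, hyx, hd⟩ := Finset.mem_filter.1 hS
    have hsub := (Finset.mem_powersetCard.1 hSU).1
    have hxU := hsub hx
    have hyU := hsub hy
    by_cases hyu : y = u
    · refine Finset.mem_union_left _ (Finset.mem_union_left _ (Finset.mem_biUnion.2 ⟨x, ?_, ?_⟩))
      · rw [hyu, abs_sub_comm] at hd
        simp only [Finset.mem_filter, mem_near]; tauto
      · simp [mem_supersets, Finset.insert_subset_iff, hSU, huS, hvS, hx, -Finset.mem_powersetCard]
    by_cases hyv : y = v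
    · refine Finset.mem_union_left _ (Finset.mem_union_right _ (Finset.mem_biUnion.2 ⟨x, ?_, ?_⟩))
      · rw [hyv, abs_sub_comm] at hd
        simp only [Finset.mem_filter, mem_near]; tauto
      · simp [mem_supersets, Finset.insert_subset_iff, hSU, huS, hvS, hx, -Finset.mem_powersetCard]
    refine Finset.mem_union_right _ (Finset.mem_biUnion.2 ⟨x, ?_, Finset.mem_biUnion.2 ⟨y, ?_, ?_⟩⟩)
    · simp only [Finset.mem_filter]; tauto
    · simp only [Finset.mem_filter, mem_near]; tauto
    · simp [mem_supersets, Finset.insert_subset_iff, hSU, huS, hvS, hx, hy,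
        -Finset.mem_powersetCard]
  have hnearcard : ∀ x ∈ U, ((near x).card : ℝ) ≤ 2 * Δ := fun x hx => hπ.card_near_le hx hΔ
  have hnearU : ∀ x y, y ∈ near x → y ∈ U ∧ y ≠ x := fun x y hy => by
    rw [Finset.mem_filter, Finset.mem_erase] at hy
    exact hy.1.symm
  have hA : ((((near u).filter fun x => x ≠ v).biUnion fun x => supersets {u, v, x}).card : ℝ) ≤
      2 * Δ * n₃ := by
    have h := Finset.card_biUnion_le_card_mul ((near u).filter fun x => x ≠ v)
      (fun x => supersets {u, v, x}) n₃ fun x hx => by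
        rw [Finset.mem_filter] at hx
        exact hcard3 x (hnearU _ _ hx.1).1 (hnearU _ _ hx.1).2 hx.2
    have h' := h.trans (Nat.mul_le_mul_right n₃ (Finset.card_filter_le (near u) _))
    calc _ ≤ ((near u).card : ℝ) * n₃ := by exact_mod_cast h'
      _ ≤ _ := by gcongr; exact hnearcard u hu
  have hB : ((((near v).filter fun x => x ≠ u).biUnion fun x => supersets {u, v, x}).card : ℝ) ≤
      2 * Δ * n₃ := by
    have h := Finset.card_biUnion_le_card_mul ((near v).filter fun x => x ≠ u)
      (fun x => supersets {u, v, x}) n₃ fun x hx => by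
        rw [Finset.mem_filter] at hx
        exact hcard3 x (hnearU _ _ hx.1).1 hx.2 (hnearU _ _ hx.1).2
    have h' := h.trans (Nat.mul_le_mul_right n₃ (Finset.card_filter_le (near v) _))
    calc _ ≤ ((near v).card : ℝ) * n₃ := by exact_mod_cast h'
      _ ≤ _ := by gcongr; exact hnearcard v hv
  have hC : (((U.filter fun x => x ≠ u ∧ x ≠ v).biUnion fun x =>
      ((near x).filter fun y => y ≠ u ∧ y ≠ v).biUnion fun y => supersets {y, u, v, x}).card : ℝ) ≤
      U.card * (2 * Δ * n₄) := by
    calc _ ≤ ∑ x ∈ U.filter fun x => x ≠ u ∧ x ≠ v,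
          ((((near x).filter fun y => y ≠ u ∧ y ≠ v).biUnion fun y =>
            supersets {y, u, v, x}).card : ℝ) := by exact_mod_cast Finset.card_biUnion_le
      _ ≤ (U.filter fun x => x ≠ u ∧ x ≠ v).card • (2 * Δ * n₄) := by
          refine Finset.sum_le_card_nsmul _ _ _ fun x hx => ?_
          rw [Finset.mem_filter] at hx
          have h := Finset.card_biUnion_le_card_mul ((near x).filter fun y => y ≠ u ∧ y ≠ v)
            (fun y => supersets {y, u, v, x}) n₄ fun y hy => by
              rw [Finset.mem_filter] at hy
              exact hcard4 x hx.1 hx.2.1 hx.2.2 y (hnearU _ _ hy.1).1 hy.2.1 hy.2.2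
                (hnearU _ _ hy.1).2
          have h' := h.trans (Nat.mul_le_mul_right n₄ (Finset.card_filter_le (near x) _))
          calc _ ≤ ((near x).card : ℝ) * n₄ := by exact_mod_cast h'
            _ ≤ _ := by gcongr; exact hnearcard x hx.1
      _ ≤ _ := by
          rw [nsmul_eq_mul]
          gcongr
          exact Finset.filter_subset _ _
  have h := (Finset.card_le_card hsub).trans ((Finset.card_union_le _ _).trans
    (Nat.add_le_add_right (Finset.card_union_le _ _) _))
  have h' : ((closeSets U k π Δ u v).card : ℝ) ≤ _ := Nat.cast_le.2 h
  rw [Nat.cast_add, Nat.cast_add] at h'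
  linarith

lemma card_closeSets_le {U : Finset α} {k : ℕ} {π : α → ℝ} (hπ : IsRankingOn U π) {Δ : ℝ}
    (hΔ : 0 ≤ Δ) {u v : α} (hu : u ∈ U) (hv : v ∈ U) (huv : u ≠ v) (hm : 6 ≤ U.card) :
    ((closeSets U k π Δ u v).card : ℝ) * U.card ≤
      8 * Δ * (k + k ^ 2) * ((if 2 ≤ k then (U.card - 2).choose (k - 2) else 0 : ℕ) : ℝ) := by
  set n₂ : ℕ := if 2 ≤ k then (U.card - 2).choose (k - 2) else 0
  set n₃ : ℕ := if 3 ≤ k then (U.card - 3).choose (k - 3) else 0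
  set n₄ : ℕ := if 4 ≤ k then (U.card - 4).choose (k - 4) else 0
  have e₃ : (n₃ : ℝ) * U.card ≤ 2 * k * n₂ := by
    exact_mod_cast choose_sub_succ_mul_card_le (m := U.card) (k := k) (a := 2) (by omega) (by omega)
  have e₄ : (n₄ : ℝ) * U.card ≤ 2 * k * n₃ := by
    exact_mod_cast choose_sub_succ_mul_card_le (m := U.card) (k := k) (a := 3) (by omega) (by omega)
  have hcard : ((closeSets U k π Δ u v).card : ℝ) ≤ 4 * Δ * n₃ + U.card * (2 * Δ * n₄) :=
    card_closeSets_le_add hπ hΔ hu hv huv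
  clear_value n₂ n₃ n₄
  calc ((closeSets U k π Δ u v).card : ℝ) * U.card
      ≤ (4 * Δ * n₃ + U.card * (2 * Δ * n₄)) * U.card := by gcongr
    _ = 2 * Δ * (2 * (n₃ * U.card) + (n₄ * U.card) * U.card) := by ring
    _ ≤ 2 * Δ * (2 * (n₃ * U.card) + (2 * k * n₃) * U.card) := by gcongr
    _ = 2 * Δ * (2 + 2 * k) * (n₃ * U.card) := by ring
    _ ≤ 2 * Δ * (2 + 2 * k) * (2 * k * n₂) := by gcongr
    _ = _ := by ring

lemma rk_eq_one {S : Finset α} {σ : α → ℝ} {u : α} (hu : u ∈ S)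
    (h : ∀ x ∈ S, x ≠ u → σ u < σ x) : rk S σ u = 1 := by
  refine Finset.card_eq_one.2 ⟨u, ?_⟩
  ext x
  rw [Finset.mem_filter, Finset.mem_singleton]
  refine ⟨fun ⟨hx, hle⟩ => ?_, fun hx => by simp [hx, hu]⟩
  by_contra hne
  exact hle.not_gt (h x hx hne)

lemma rk_eq_card {S : Finset α} {σ : α → ℝ} {v : α}
    (h : ∀ x ∈ S, σ x ≤ σ v) : rk S σ v = S.card := by
  rw [rk, Finset.filter_true_of_mem h]

lemma rk_eq_two {S : Finset α} {σ : α → ℝ} {u v : α} (hu : u ∈ S) (hv : v ∈ S)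
    (huv : σ u < σ v) (h : ∀ x ∈ S, x ≠ u → x ≠ v → σ v < σ x) : rk S σ v = 2 := by
  refine Finset.card_eq_two.2 ⟨u, v, fun he => huv.ne (congrArg σ he), ?_⟩
  ext x
  rw [Finset.mem_filter, Finset.mem_insert, Finset.mem_singleton]
  refine ⟨fun ⟨hx, hle⟩ => ?_, ?_⟩
  · by_contra! hne
    exact hle.not_gt (h x hx hne.1 hne.2)
  · rintro (rfl | rfl)
    · exact ⟨hu, huv.le⟩
    · exact ⟨hv, le_rfl⟩

lemma rk_eq_card_sub_one {S : Finset α} {σ : α → ℝ} {u v : α} (hv : v ∈ S)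
    (huv : σ u < σ v) (h : ∀ x ∈ S, x ≠ v → σ x ≤ σ u) : rk S σ u = S.card - 1 := by
  rw [rk, ← Finset.card_erase_of_mem hv]
  congr 1
  ext x
  rw [Finset.mem_filter, Finset.mem_erase]
  refine ⟨fun ⟨hx, hle⟩ => ⟨?_, hx⟩, fun ⟨hne, hx⟩ => ⟨hx, h x hx hne⟩⟩
  rintro rfl
  exact hle.not_gt huv

lemma WeaklyFragileOn.one_le_add_moveBefore {S : Finset α} {c : (α → ℝ) → ℕ}
    (hc : WeaklyFragileOn S c) (hinv : ∀ σ σ' : α → ℝ, SameOrderOn S σ σ' → c σ = c σ')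
    {σ : α → ℝ} (hσ : IsOrderingOn S σ) {u v : α} (hu : u ∈ S) (hv : v ∈ S) (huv : σ u < σ v)
    (h : (∀ x ∈ S, x ≠ u → x ≠ v → σ x < σ u) ∨
      (∀ x ∈ S, x ≠ u → x ≠ v → σ u < σ x ∧ σ x < σ v) ∨
      (∀ x ∈ S, x ≠ u → x ≠ v → σ v < σ x)) :
    1 ≤ c σ + c (moveBefore S σ v u) := by
  have hne : u ≠ v := fun he => huv.ne (congrArg σ he)
  have hτ := isOrderingOn_moveBefore hσ v hu
  have hτs := sameOrderOn_rk S (moveBefore S σ v u)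
  rw [← hinv _ _ (sameOrderOn_rk S σ), ← hinv _ _ hτs]
  refine hc _ _ (isRankingOn_rk hσ) (isRankingOn_rk hτ) ?_
  have hdiff : ∃ x ∈ S, (rk S σ x : ℝ) ≠ rk S (moveBefore S σ v u) x := by
    by_contra! heq
    have h1 : (rk S σ u : ℝ) < rk S σ v := Nat.cast_lt.2 ((rk_lt_rk_iff hv).2 huv)
    rw [heq u hu, heq v hv, Nat.cast_lt, rk_lt_rk_iff hv] at h1
    exact h1.not_gt ((moveBefore_self_lt_iff hu hne).2 le_rfl)
  have hcard : 1 ≤ S.card := Finset.card_pos.2 ⟨u, hu⟩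
  rcases h with h | h | h
  · have hu' : rk S σ u = S.card - 1 := by
      refine rk_eq_card_sub_one hv huv fun x hx hxv => ?_
      rcases eq_or_ne x u with rfl | hxu
      · exact le_rfl
      · exact (h x hx hxu hxv).le
    have hv' : rk S σ v = S.card := by
      refine rk_eq_card fun x hx => ?_
      rcases eq_or_ne x v with rfl | hxv
      · exact le_rfl
      rcases eq_or_ne x u with rfl | hxu
      · exact huv.le
      · exact ((h x hx hxu hxv).trans huv).le
    refine ⟨v, hv, (rk S σ u : ℝ) - 1 / 2, .inr (.inr (.inl ⟨congrArg Nat.cast hv', ?_⟩)),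
      hτs, hdiff⟩
    rw [hu']
    push_cast [hcard]
    ring
  · have hu' : rk S σ u = 1 := by
      refine rk_eq_one hu fun x hx hxu => ?_
      rcases eq_or_ne x v with rfl | hxv
      · exact huv
      · exact (h x hx hxu hxv).1
    have hv' : rk S σ v = S.card := by
      refine rk_eq_card fun x hx => ?_
      rcases eq_or_ne x v with rfl | hxv
      · exact le_rfl
      rcases eq_or_ne x u with rfl | hxu
      · exact huv.le
      · exact (h x hx hxu hxv).2.le
    refine ⟨v, hv, (rk S σ u : ℝ) - 1 / 2, .inr (.inr (.inr ⟨congrArg Nat.cast hv', ?_⟩)),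
      hτs, hdiff⟩
    rw [hu']
    norm_num
  · have hu' : rk S σ u = 1 := by
      refine rk_eq_one hu fun x hx hxu => ?_
      rcases eq_or_ne x v with rfl | hxv
      · exact huv
      · exact huv.trans (h x hx hxu hxv)
    have hv' : rk S σ v = 2 := rk_eq_two hu hv huv h
    have hother : ∀ x ∈ S, x ≠ u → x ≠ v → (3 : ℝ) ≤ rk S σ x := by
      intro x hx hxu hxv
      have := (rk_lt_rk_iff hx).2 (h x hx hxu hxv)
      rw [hv'] at this
      exact_mod_cast this
    refine ⟨u, hu, 2 + 1 / 2, .inl ⟨by simp [hu'], rfl⟩, hτs.trans ?_, hdiff⟩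
    intro x hx y hy
    by_cases hxy : x = y
    · simp [hxy]
    by_cases hxv : x = v
    · subst hxv
      rw [moveBefore_self_lt_iff hu (Ne.symm hxy), Function.update_of_ne (Ne.symm hne), hv']
      by_cases hyu : y = u
      · subst hyu
        simp
      · rw [Function.update_of_ne hyu]
        have h3 := hother y hy hyu (Ne.symm hxy)
        exact iff_of_true (huv.trans (h y hy hyu (Ne.symm hxy))).le (by push_cast; linarith)
    by_cases hyv : y = v
    · subst hyv
      rw [moveBefore_lt_self_iff hu hxy, Function.update_of_ne (Ne.symm hne), hv']
      by_cases hxu : x = u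
      · subst hxu
        simp
      · rw [Function.update_of_ne hxu]
        have h3 := hother x hx hxu hxy
        exact iff_of_false (huv.trans (h x hx hxu hxy)).not_gt (by push_cast; linarith)
    rw [moveBefore_lt_iff hy hxv hyv]
    by_cases hxu : x = u
    · subst hxu
      have hyu := Ne.symm hxy
      rw [Function.update_self, Function.update_of_ne hyu]
      have h3 := hother y hy hyu hyv
      exact iff_of_true (huv.trans (h y hy hyu hyv)) (by linarith)
    by_cases hyu : y = u
    · subst hyu
      rw [Function.update_self, Function.update_of_ne hxu]
      have h3 := hother x hx hxu hxv
      exact iff_of_false (huv.trans (h x hx hxu hxv)).not_gt (by linarith)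
    · rw [Function.update_of_ne hxu, Function.update_of_ne hyu, Nat.cast_lt, rk_lt_rk_iff hy]

lemma choose_le_six_pow_mul_choose {n a j : ℕ} (h : n ≤ 3 * a) (hn : 6 * j ≤ n) :
    n.choose j ≤ 6 ^ j * a.choose j := by
  have hpos := Nat.factorial_pos j
  refine Nat.le_of_mul_le_mul_left ?_ hpos
  rw [← Nat.descFactorial_eq_factorial_mul_choose, mul_left_comm,
    ← Nat.descFactorial_eq_factorial_mul_choose]
  calc n.descFactorial j ≤ n ^ j := Nat.descFactorial_le_pow n j
    _ ≤ (6 * (a + 1 - j)) ^ j := Nat.pow_le_pow_left (by omega) j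
    _ = 6 ^ j * (a + 1 - j) ^ j := mul_pow _ _ _
    _ ≤ 6 ^ j * a.descFactorial j := Nat.mul_le_mul_left _ (Nat.pow_sub_le_descFactorial a j)

lemma choose_card_le_wgt_add_wgt_of_lt {U : Finset α} {k : ℕ} (hk : 2 ≤ k)
    {c : Finset α → (α → ℝ) → ℕ} (hc : IsConstraintSystem U k c)
    (hf : WeaklyFragileSystem U k c) {σ : α → ℝ} (hσ : IsOrderingOn U σ) {u v : α}
    (hu : u ∈ U) (hv : v ∈ U) (huv : σ u < σ v) {R : Finset α} (hR : R ⊆ U)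
    (huR : u ∉ R) (hvR : v ∉ R)
    (h : (∀ x ∈ R, σ x < σ u) ∨ (∀ x ∈ R, σ u < σ x ∧ σ x < σ v) ∨ (∀ x ∈ R, σ v < σ x)) :
    R.card.choose (k - 2) ≤ wgt U k c σ u v + wgt U k c σ v u := by
  have hne : u ≠ v := fun he => huv.ne (congrArg σ he)
  rw [wgt_eq_card_filter, wgt_eq_card_filter, ← Finset.card_powersetCard]
  refine (Finset.card_le_card_of_injOn (fun T => insert u (insert v T)) ?_ ?_).trans
    (Finset.card_union_le _ _)
  · intro T hT
    rw [Finset.mem_coe, Finset.mem_powersetCard] at hT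
    have huT : u ∉ T := fun h => huR (hT.1 h)
    have hvT : v ∉ T := fun h => hvR (hT.1 h)
    set S := insert u (insert v T) with hS
    have huS : u ∈ S := by simp [hS]
    have hvS : v ∈ S := by simp [hS]
    have hTS : ∀ x ∈ S, x ≠ u → x ≠ v → x ∈ R := by
      intro x hx hxu hxv
      simp only [hS, Finset.mem_insert, hxu, hxv, false_or] at hx
      exact hT.1 hx
    have hSU : S ∈ U.powersetCard k := by
      rw [Finset.mem_powersetCard]
      constructor
      · simp [hS, Finset.insert_subset_iff, hu, hv, hT.1.trans hR]
      · rw [hS, Finset.card_insert_of_notMem (by simp [hne, huT]),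
          Finset.card_insert_of_notMem hvT, hT.2]
        omega
    have hsub := (Finset.mem_powersetCard.1 hSU).1
    have h1 := (hf S hSU).one_le_add_moveBefore (hc S hSU).2 (hσ.mono hsub) huS hvS huv <| by
      refine h.imp (fun h x hx hxu hxv => h x (hTS x hx hxu hxv)) (Or.imp ?_ ?_) <;>
      exact fun h x hx hxu hxv => h x (hTS x hx hxu hxv)
    have e1 : placeBefore S σ u v = moveBefore S σ v u := if_pos huv
    have e2 : placeBefore S σ v u = σ := if_neg huv.not_gt
    have h2 := (hc S hSU).1 σ
    have h3 := (hc S hSU).1 (moveBefore S σ v u)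
    change S ∈ _
    rw [Finset.mem_coe, Finset.mem_union, Finset.mem_filter, Finset.mem_filter, e1, e2]
    rcases Nat.eq_zero_or_pos (c S σ) with h0 | h0
    · exact .inl ⟨hSU, huS, hvS, by omega⟩
    · exact .inr ⟨hSU, hvS, huS, by omega⟩
  · intro T hT T' hT' he
    rw [Finset.mem_coe, Finset.mem_powersetCard] at hT hT'
    have key : ∀ Q : Finset α, Q ⊆ R → ((insert u (insert v Q)).erase u).erase v = Q := by
      intro Q hQ
      rw [Finset.erase_insert, Finset.erase_insert fun h => hvR (hQ h)]
      simp only [Finset.mem_insert, hne, false_or]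
      exact fun h => huR (hQ h)
    simp only at he
    rw [← key T hT.1, he, key T' hT'.1]

lemma choose_le_six_pow_mul_wgt_add_wgt {U : Finset α} {k : ℕ} (hk : 2 ≤ k)
    (hU : 6 * k ≤ U.card) {c : Finset α → (α → ℝ) → ℕ} (hc : IsConstraintSystem U k c)
    (hf : WeaklyFragileSystem U k c) {σ : α → ℝ} (hσ : IsOrderingOn U σ) {u v : α}
    (hu : u ∈ U) (hv : v ∈ U) (huv : u ≠ v) :
    (U.card - 2).choose (k - 2) ≤
      6 ^ (k - 2) * (wgt U k c σ u v + wgt U k c σ v u) := by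
  wlog hlt : σ u < σ v generalizing u v
  · rw [add_comm]
    exact this hv hu huv.symm
      (lt_of_le_of_ne (not_lt.1 hlt) fun he => huv (hσ hu hv he.symm))
  set V := (U.erase u).erase v with hV
  have hVcard : V.card = U.card - 2 := by
    rw [hV, Finset.card_erase_of_mem (Finset.mem_erase.2 ⟨huv.symm, hv⟩),
      Finset.card_erase_of_mem hu, Nat.sub_sub]
  set A := V.filter fun x => σ x < σ u with hA
  set B := V.filter fun x => σ u < σ x ∧ σ x < σ v with hB
  set C := V.filter fun x => σ v < σ x with hC
  have hVU : V ⊆ U := (Finset.erase_subset _ _).trans (Finset.erase_subset _ _)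
  have hcover : V.card ≤ A.card + B.card + C.card := by
    refine (Finset.card_le_card fun x hx => ?_).trans ((Finset.card_union_le (A ∪ B) C).trans
      (Nat.add_le_add_right (Finset.card_union_le _ _) _))
    have hx' := hx
    rw [hV, Finset.mem_erase, Finset.mem_erase] at hx'
    have h1 : σ x ≠ σ u := fun he => hx'.2.1 (hσ hx'.2.2 hu he)
    have h2 : σ x ≠ σ v := fun he => hx'.1 (hσ hx'.2.2 hv he)
    rw [Finset.mem_union, Finset.mem_union, hA, hB, hC, Finset.mem_filter, Finset.mem_filter,
      Finset.mem_filter]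
    rcases h1.lt_or_gt with h1 | h1
    · exact .inl (.inl ⟨hx, h1⟩)
    rcases h2.lt_or_gt with h2 | h2
    · exact .inl (.inr ⟨hx, h1, h2⟩)
    · exact .inr ⟨hx, h2⟩
  have huV : u ∉ V := by simp [hV]
  have hvV : v ∉ V := by simp [hV]
  have main : ∀ R ⊆ V, U.card - 2 ≤ 3 * R.card → ((∀ x ∈ R, σ x < σ u) ∨
      (∀ x ∈ R, σ u < σ x ∧ σ x < σ v) ∨ (∀ x ∈ R, σ v < σ x)) →
      (U.card - 2).choose (k - 2) ≤
        6 ^ (k - 2) * (wgt U k c σ u v + wgt U k c σ v u) := by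
    intro R hR hcard h
    exact (choose_le_six_pow_mul_choose hcard (by omega)).trans (Nat.mul_le_mul_left _
      (choose_card_le_wgt_add_wgt_of_lt hk hc hf hσ hu hv hlt (hR.trans hVU)
        (fun h => huV (hR h)) (fun h => hvV (hR h)) h))
  have hcases : U.card - 2 ≤ 3 * A.card ∨ U.card - 2 ≤ 3 * B.card ∨ U.card - 2 ≤ 3 * C.card := by
    omega
  rcases hcases with h | h | h
  · exact main A (Finset.filter_subset _ _) h (.inl fun x hx => (Finset.mem_filter.1 hx).2)
  · exact main B (Finset.filter_subset _ _) h
      (.inr (.inl fun x hx => (Finset.mem_filter.1 hx).2))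
  · exact main C (Finset.filter_subset _ _) h
      (.inr (.inr fun x hx => (Finset.mem_filter.1 hx).2))

end

/-- for fully dense weakly fragile arity-`k` constraint systems on a
sufficiently large set `U` (`|U| = m ≥ m₀`), `0 < ε ≤ ε₀`, a ranking `π` and an ordering
`σ` of `U` with `|π(x) − σ(x)| ≤ D·ε·m` for all `x`, one has
`w̄^σ_{uv} ≤ (1 + C'·ε)·w^π_{uv}` for all distinct `u, v ∈ U`. -/
theorem wbar_close_multiplicative (k : ℕ) (hk : 2 ≤ k) (D : ℝ) (hD : 0 < D) :
    ∃ C' : ℝ, ∃ m₀ : ℕ, ∃ ε₀ : ℝ, 0 < ε₀ ∧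
      ∀ (α : Type u) (U : Finset α) (m : ℕ), U.card = m → m₀ ≤ m →
      ∀ c : Finset α → (α → ℝ) → ℕ, IsConstraintSystem U k c → WeaklyFragileSystem U k c →
      ∀ ε : ℝ, 0 < ε → ε ≤ ε₀ →
      ∀ (π σ : α → ℝ), IsRankingOn U π → IsOrderingOn U σ →
      (∀ x ∈ U, |π x - σ x| ≤ D * ε * (m : ℝ)) →
      ∀ u ∈ U, ∀ v ∈ U, u ≠ v →
        wbar U k c σ u v ≤ (1 + C' * ε) * (wgt U k c π u v : ℝ) := by
  set c₀ : ℝ := 1 / 6 ^ (k - 2) with hc₀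
  set t : ℝ := 1 / (10 * 3 ^ (k - 1)) with ht
  set K : ℝ := 16 * D * (k + k ^ 2) with hK
  have hc₀pos : 0 < c₀ := by positivity
  have htpos : 0 < t := by positivity
  have hkpos : (0 : ℝ) < k := by exact_mod_cast (by omega : 0 < k)
  have hKpos : 0 < K := by positivity
  refine ⟨2 * K / c₀, 6 * k, min (c₀ / 4) t / K, by positivity, ?_⟩
  intro α U m hUm hm c hc hf ε hε hεle π σ hπ hσ hclose u hu v hv huv
  subst hUm
  set N : ℝ := ((U.card - 2).choose (k - 2) : ℝ) with hN
  have hNnonneg : 0 ≤ N := Nat.cast_nonneg _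
  have hεK : K * ε ≤ min (c₀ / 4) t := by
    rw [mul_comm]
    exact (le_div_iff₀ hKpos).1 hεle
  have hεc : K * ε ≤ c₀ / 4 := hεK.trans (min_le_left _ _)
  have hεt : K * ε ≤ t := hεK.trans (min_le_right _ _)
  have hUpos : (0 : ℝ) < U.card := by exact_mod_cast (by omega : 0 < U.card)
  have hbad : ((closeSets U k π (2 * (D * ε * U.card)) u v).card : ℝ) ≤ K * ε * N := by
    have h := card_closeSets_le (k := k) hπ (Δ := 2 * (D * ε * U.card)) (by positivity) hu hv huv
      (by omega)
    rw [if_pos hk] at h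
    refine le_of_mul_le_mul_right (h.trans_eq ?_) hUpos
    rw [hK]
    ring
  have hle : (wgt U k c σ u v : ℝ) ≤ wgt U k c π u v + K * ε * N := by
    have h : (wgt U k c σ u v : ℝ) ≤ wgt U k c π u v +
        (closeSets U k π (2 * (D * ε * U.card)) u v).card := by
      exact_mod_cast wgt_le_wgt_add_card_closeSets hc hπ.isOrderingOn hσ hclose huv
    linarith
  have hsum : c₀ * N ≤ wgt U k c σ u v + wgt U k c σ v u := by
    have h : N ≤ 6 ^ (k - 2) * ((wgt U k c σ u v : ℝ) + wgt U k c σ v u) := by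
      rw [hN]
      exact_mod_cast choose_le_six_pow_mul_wgt_add_wgt hk hm hc hf hσ hu hv huv
    rw [hc₀, one_div_mul_eq_div, div_le_iff₀' (by positivity)]
    exact h
  have hwπ : (0 : ℝ) ≤ wgt U k c π u v := Nat.cast_nonneg _
  have hwσ : (0 : ℝ) ≤ wgt U k c σ u v := Nat.cast_nonneg _
  have hwσ' : (0 : ℝ) ≤ wgt U k c σ v u := Nat.cast_nonneg _
  change (wgt U k c σ u v : ℝ) - min (t * N) (min (wgt U k c σ u v : ℝ) (wgt U k c σ v u)) ≤ _
  by_cases hbig : c₀ / 2 * N ≤ wgt U k c π u v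
  · have hmin : 0 ≤ min (t * N) (min (wgt U k c σ u v : ℝ) (wgt U k c σ v u)) := by positivity
    have h : K * ε * N ≤ 2 * K / c₀ * ε * wgt U k c π u v := by
      calc K * ε * N = 2 * K / c₀ * ε * (c₀ / 2 * N) := by field_simp
        _ ≤ _ := by gcongr
    linarith
  · have hext : (0 : ℝ) ≤ 2 * K / c₀ * ε * wgt U k c π u v := by positivity
    suffices h : (wgt U k c σ u v : ℝ) -
        min (t * N) (min (wgt U k c σ u v : ℝ) (wgt U k c σ v u)) ≤ wgt U k c π u v by linarith
    have hN1 : K * ε * N ≤ c₀ / 4 * N := by gcongr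
    have hN2 : K * ε * N ≤ t * N := by gcongr
    have hmin : min (K * ε * N) (wgt U k c σ u v : ℝ) ≤
        min (t * N) (min (wgt U k c σ u v : ℝ) (wgt U k c σ v u)) := by
      refine le_min ((min_le_left _ _).trans hN2) (le_min (min_le_right _ _)
        ((min_le_left _ _).trans ?_))
      linarith
    rcases min_cases (K * ε * N) (wgt U k c σ u v : ℝ) with ⟨h, -⟩ | ⟨h, -⟩ <;>
      rw [h] at hmin <;> linarith
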